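/- Let π be an almost consecutive permutation of {1,…,n+1} and let f : ℝ → ℝ be a probability density function with f(−x) = f(x) for all x ∈ ℝ. Then P(f,π) = 1/(2^n · ∏_{j=1}^n lev(π)_j). -/

import Mathlib

open MeasureTheory

noncomputable section

/-- Walk positions: `walk n x i = x 0 + ⋯ + x (i-1)` (so `walk n x 0 = 0`). -/
def walk (n : ℕ) (x : Fin n → ℝ) (i : Fin (n + 1)) : ℝ :=
  ∑ j : Fin n, if (j : ℕ) < (i : ℕ) then x j else 0

/-- The region of step tuples generating the ordinal pattern `π`. -/
def D (n : ℕ) (π : Equiv.Perm (Fin (n + 1))) : Set (Fin n → ℝ) :=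
  {x | (∀ i j : Fin (n + 1), i ≠ j → walk n x i ≠ walk n x j) ∧
       (∀ i j : Fin (n + 1), walk n x i < walk n x j ↔ π i < π j)}

/-- The matrix `L_π`. -/
def L (n : ℕ) (π : Equiv.Perm (Fin (n + 1))) : Matrix (Fin n) (Fin n) ℝ :=
  fun i j =>
    if (π i.castSucc : ℕ) ≤ (j : ℕ) ∧ (j : ℕ) < (π i.succ : ℕ) then 1
    else if (π i.succ : ℕ) ≤ (j : ℕ) ∧ (j : ℕ) < (π i.castSucc : ℕ) then -1
    else 0

/-- Partial sum `x i + x (i+1) + ⋯ + x (j-1)`. -/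
def psum (n : ℕ) (x : Fin n → ℝ) (i j : Fin (n + 1)) : ℝ :=
  ∑ k : Fin n, if (i : ℕ) ≤ (k : ℕ) ∧ (k : ℕ) < (j : ℕ) then x k else 0

/-- The level count `lev(π)_j`. -/
def lev (n : ℕ) (π : Equiv.Perm (Fin (n + 1))) (j : Fin n) : ℕ :=
  (Finset.univ.filter fun i : Fin n =>
    ((π i.castSucc : ℕ) ≤ (j : ℕ) ∧ (j : ℕ) < (π i.succ : ℕ)) ∨
    ((π i.succ : ℕ) ≤ (j : ℕ) ∧ (j : ℕ) < (π i.castSucc : ℕ))).card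

/-- The polytope of steps `P_π`. -/
def Ppoly (n : ℕ) (π : Equiv.Perm (Fin (n + 1))) : Set (Fin n → ℝ) :=
  {x | (∀ i, 0 ≤ x i) ∧ ∀ i : Fin n,
    psum n x (min (π i.castSucc) (π i.succ)) (max (π i.castSucc) (π i.succ)) ≤ 1}

/-- The set of positive roots, identified with pairs `i < j`. -/
def PosRoot (n : ℕ) := {p : Fin (n + 1) × Fin (n + 1) // p.1 < p.2}

/-- The Shi condition for an alcove address. -/
def Shi (n : ℕ) (k : PosRoot n → ℤ) : Prop :=
  ∀ (i t j : Fin (n + 1)) (hit : i < t) (htj : t < j),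
    k ⟨(i, t), hit⟩ + k ⟨(t, j), htj⟩ ≤ k ⟨(i, j), hit.trans htj⟩ ∧
    k ⟨(i, j), hit.trans htj⟩ ≤ k ⟨(i, t), hit⟩ + k ⟨(t, j), htj⟩ + 1

/-- The alcove with address `k`, in step coordinates. -/
def alcove (n : ℕ) (k : PosRoot n → ℤ) : Set (Fin n → ℝ) :=
  {x | ∀ p : PosRoot n,
    (k p : ℝ) < psum n x p.1.1 p.1.2 ∧ psum n x p.1.1 p.1.2 < (k p : ℝ) + 1}

/-- The root ideal `I_π`. -/
def rootIdeal (n : ℕ) (π : Equiv.Perm (Fin (n + 1))) : Set (PosRoot n) :=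
  {p | ∃ c : Fin n,
    min (π c.castSucc : ℕ) (π c.succ : ℕ) ≤ (p.1.1 : ℕ) ∧
    (p.1.2 : ℕ) ≤ max (π c.castSucc : ℕ) (π c.succ : ℕ)}

/-- The level count matrix `lev(π)_{i,j}`. -/
def lev2 (n : ℕ) (π : Equiv.Perm (Fin (n + 1))) (i j : Fin n) : ℕ :=
  (Finset.univ.filter fun k : Fin n =>
    ((π k.castSucc : ℕ) ≤ (i : ℕ) ∧ (π k.castSucc : ℕ) ≤ (j : ℕ) ∧
     (i : ℕ) < (π k.succ : ℕ) ∧ (j : ℕ) < (π k.succ : ℕ)) ∨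
    ((π k.succ : ℕ) ≤ (i : ℕ) ∧ (π k.succ : ℕ) ≤ (j : ℕ) ∧
     (i : ℕ) < (π k.castSucc : ℕ) ∧ (j : ℕ) < (π k.castSucc : ℕ))).card

open Set Filter Topology

section StepMatrix

variable {n : ℕ}

theorem mem_D_iff_strictMono (π : Equiv.Perm (Fin (n + 1))) (x : Fin n → ℝ) :
    x ∈ D n π ↔ StrictMono fun k => walk n x (π.symm k) := by
  constructor
  · rintro ⟨-, h⟩ a b hab
    exact (h _ _).2 (by simpa using hab)
  · intro h
    have key : ∀ i j, walk n x i < walk n x j ↔ π i < π j := fun i j => by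
      simpa using h.lt_iff_lt (a := π i) (b := π j)
    refine ⟨fun i j hij he => hij (π.injective (h.injective ?_)), key⟩
    simpa using he

theorem L_apply_eq_sub (π : Equiv.Perm (Fin (n + 1))) (i j : Fin n) :
    L n π i j = (if (j : ℕ) < (π i.succ : ℕ) then 1 else 0) -
      (if (j : ℕ) < (π i.castSucc : ℕ) then 1 else 0) := by
  unfold L
  split_ifs <;> first | omega | norm_num

theorem L_mulVec_apply (π : Equiv.Perm (Fin (n + 1))) (x : Fin n → ℝ) (i : Fin n) :
    (L n π).mulVec x i = walk n x (π i.succ) - walk n x (π i.castSucc) := by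
  simp only [Matrix.mulVec, dotProduct, L_apply_eq_sub, walk, ← Finset.sum_sub_distrib]
  refine Finset.sum_congr rfl fun j _ => ?_
  split_ifs <;> ring

theorem walk_zero (x : Fin n → ℝ) : walk n x 0 = 0 := by simp [walk]

theorem walk_succ (x : Fin n → ℝ) (i : Fin n) :
    walk n x i.succ = walk n x i.castSucc + x i := by
  have h : x i = ∑ j : Fin n, if j = i then x j else 0 := by simp
  conv_rhs => rw [h]
  simp only [walk, ← Finset.sum_add_distrib]
  refine Finset.sum_congr rfl fun j _ => ?_
  simp only [Fin.ext_iff, Fin.val_succ, Fin.val_castSucc]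
  split_ifs <;> first | omega | simp

theorem mem_D_iff (π : Equiv.Perm (Fin (n + 1))) (x : Fin n → ℝ) :
    x ∈ D n π ↔ ∀ j, 0 < (L n π.symm).mulVec x j := by
  rw [mem_D_iff_strictMono, Fin.strictMono_iff_lt_succ]
  simp [L_mulVec_apply]

theorem walk_L_mulVec (π : Equiv.Perm (Fin (n + 1))) (x : Fin n → ℝ) (k : Fin (n + 1)) :
    walk n ((L n π).mulVec x) k = walk n x (π k) - walk n x (π 0) := by
  induction k using Fin.induction with
  | zero => simp [walk_zero]
  | succ i ih => rw [walk_succ, ih, L_mulVec_apply]; ring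

theorem L_symm_mulVec_L_mulVec (π : Equiv.Perm (Fin (n + 1))) (x : Fin n → ℝ) :
    (L n π.symm).mulVec ((L n π).mulVec x) = x := by
  ext j
  simp [L_mulVec_apply π.symm, walk_L_mulVec, walk_succ]

theorem L_symm_mul_L (π : Equiv.Perm (Fin (n + 1))) : L n π.symm * L n π = 1 :=
  Matrix.toLin'.injective <| LinearMap.ext fun x => by
    rw [Matrix.toLin'_mul, LinearMap.comp_apply, Matrix.toLin'_apply, Matrix.toLin'_apply,
      L_symm_mulVec_L_mulVec, Matrix.toLin'_one, LinearMap.id_apply]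

theorem exists_int_det_L (π : Equiv.Perm (Fin (n + 1))) : ∃ k : ℤ, (L n π).det = k := by
  let M : Matrix (Fin n) (Fin n) ℤ := fun i j =>
    (if (j : ℕ) < (π i.succ : ℕ) then 1 else 0) - (if (j : ℕ) < (π i.castSucc : ℕ) then 1 else 0)
  refine ⟨M.det, ?_⟩
  have h : L n π = (Int.castRingHom ℝ).mapMatrix M := by
    ext i j
    rw [RingHom.mapMatrix_apply, Matrix.map_apply, L_apply_eq_sub]
    simp [M]
  rw [h, ← RingHom.map_det]
  simp

theorem abs_det_L (π : Equiv.Perm (Fin (n + 1))) : |(L n π).det| = 1 := by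
  obtain ⟨k, hk⟩ := exists_int_det_L π
  obtain ⟨l, hl⟩ := exists_int_det_L π.symm
  have h : l * k = 1 := by
    have := congrArg Matrix.det (L_symm_mul_L π)
    rw [Matrix.det_mul, hk, hl, Matrix.det_one] at this
    exact_mod_cast this
  rw [hk, ← Int.cast_abs, Int.isUnit_iff_abs_eq.1 (IsUnit.of_mul_eq_one_right _ h), Int.cast_one]

theorem measurePreserving_L_mulVec (π : Equiv.Perm (Fin (n + 1))) :
    MeasurePreserving (L n π).mulVec := by
  have hne : (L n π).det ≠ 0 := abs_pos.1 (by rw [abs_det_L]; norm_num)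
  refine ⟨(Matrix.toLin' (L n π)).continuous_of_finiteDimensional.measurable, ?_⟩
  have := Real.map_matrix_volume_pi_eq_smul_volume_pi hne
  rw [abs_inv, abs_det_L, inv_one, ENNReal.ofReal_one, one_smul] at this
  exact this

theorem measurableEmbedding_L_mulVec (π : Equiv.Perm (Fin (n + 1))) :
    MeasurableEmbedding (L n π).mulVec :=
  (Matrix.toLin' (L n π)).continuous_of_finiteDimensional.measurableEmbedding
    (Function.LeftInverse.injective (L_symm_mulVec_L_mulVec π))

theorem preimage_L_mulVec_D (π : Equiv.Perm (Fin (n + 1))) :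
    (L n π).mulVec ⁻¹' D n π = univ.pi fun _ => Ioi 0 := by
  ext y
  simp [mem_D_iff, L_symm_mul_L]

theorem measurableSet_D (π : Equiv.Perm (Fin (n + 1))) : MeasurableSet (D n π) := by
  have h : D n π = (L n π.symm).mulVec ⁻¹' univ.pi fun _ => Ioi 0 := by
    ext x
    simp [mem_D_iff]
  rw [h]
  exact (measurePreserving_L_mulVec π.symm).measurable
    (MeasurableSet.univ_pi fun _ => measurableSet_Ioi)

theorem volume_exists_L_mulVec_eq_zero (π : Equiv.Perm (Fin (n + 1))) :
    volume {x | ∃ j, (L n π).mulVec x j = 0} = 0 := by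
  rw [ofPred_exists, measure_iUnion_null_iff]
  intro j
  have hS : MeasurableSet {y : Fin n → ℝ | y j = 0} :=
    measurable_pi_apply j (measurableSet_singleton 0)
  have := (measurePreserving_L_mulVec π).measure_preimage hS.nullMeasurableSet
  exact this.trans (Measure.pi_hyperplane _ j 0)

end StepMatrix

section Laplace

variable {n : ℕ}

theorem abs_L_mulVec_apply (π : Equiv.Perm (Fin (n + 1))) {y : Fin n → ℝ} (hy : ∀ j, 0 ≤ y j)
    (i : Fin n) : |(L n π).mulVec y i| = ∑ j, |L n π i j| * y j := by
  have hsign : (∀ j, 0 ≤ L n π i j) ∨ ∀ j, L n π i j ≤ 0 := by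
    rcases le_total (π i.castSucc : ℕ) (π i.succ : ℕ) with h | h
    · left; intro j; unfold L; split_ifs <;> first | omega | norm_num
    · right; intro j; unfold L; split_ifs <;> first | omega | norm_num
  simp only [Matrix.mulVec, dotProduct]
  rcases hsign with h | h
  · rw [abs_of_nonneg (Finset.sum_nonneg fun j _ => mul_nonneg (h j) (hy j))]
    simp only [abs_of_nonneg (h _)]
  · rw [abs_of_nonpos (Finset.sum_nonpos fun j _ => mul_nonpos_of_nonpos_of_nonneg (h j) (hy j))]
    simp only [abs_of_nonpos (h _), neg_mul, Finset.sum_neg_distrib]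

theorem sum_abs_L (π : Equiv.Perm (Fin (n + 1))) (j : Fin n) :
    ∑ i, |L n π i j| = (lev n π j : ℝ) := by
  rw [lev, Finset.card_filter, Nat.cast_sum]
  refine Finset.sum_congr rfl fun i _ => ?_
  unfold L
  split_ifs <;> first | omega | simp

theorem prod_laplace_L_mulVec (π : Equiv.Perm (Fin (n + 1))) {y : Fin n → ℝ}
    (hy : ∀ j, 0 ≤ y j) :
    ∏ i, Real.exp (-|(L n π).mulVec y i|) / 2 =
      (1 / 2 ^ n) * ∏ j, Real.exp (-(lev n π j : ℝ) * y j) := by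
  rw [Finset.prod_div_distrib, ← Real.exp_sum, ← Real.exp_sum, Finset.prod_const,
    Finset.card_univ, Fintype.card_fin, div_eq_mul_one_div, mul_comm]
  congr 2
  simp only [abs_L_mulVec_apply π hy, neg_mul, Finset.sum_neg_distrib, ← sum_abs_L,
    Finset.sum_mul]
  rw [Finset.sum_comm]

theorem setIntegral_Ioi_exp_neg_natCast_mul (m : ℕ) :
    ∫ x in Ioi (0 : ℝ), Real.exp (-(m : ℝ) * x) = 1 / m := by
  rcases Nat.eq_zero_or_pos m with rfl | hm
  · simp [measureReal_def]
  · rw [integral_exp_mul_Ioi (by simpa using hm)]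
    simp

theorem setIntegral_D_laplace (π : Equiv.Perm (Fin (n + 1))) :
    ∫ x in D n π, ∏ i, Real.exp (-|x i|) / 2 = 1 / (2 ^ n * ∏ j, (lev n π j : ℝ)) := by
  rw [← (measurePreserving_L_mulVec π).setIntegral_preimage_emb (measurableEmbedding_L_mulVec π),
    preimage_L_mulVec_D, setIntegral_congr_fun
      (f := fun y => ∏ i, Real.exp (-|(L n π).mulVec y i|) / 2)
      (g := fun y => (1 / 2 ^ n) * ∏ j, Real.exp (-(lev n π j : ℝ) * y j))
      (MeasurableSet.univ_pi fun _ => measurableSet_Ioi)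
      fun y hy => prod_laplace_L_mulVec π fun j => le_of_lt (hy j (mem_univ j)),
    integral_const_mul, volume_pi, Measure.restrict_pi_pi,
    integral_fintype_prod_eq_prod (f := fun j (t : ℝ) => Real.exp (-(lev n π j : ℝ) * t))]
  simp only [setIntegral_Ioi_exp_neg_natCast_mul, Finset.prod_div_distrib, Finset.prod_const_one]
  rw [div_mul_div_comm, one_mul]

theorem integral_exp_neg_abs_div_two : ∫ x : ℝ, Real.exp (-|x|) / 2 = 1 := by
  rw [integral_div, integral_comp_abs (f := fun x => Real.exp (-x)), integral_exp_neg_Ioi_zero]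
  norm_num

end Laplace

section ProbabilityIntegralTransform

open ProbabilityTheory

theorem continuous_cdf (μ : Measure ℝ) [IsProbabilityMeasure μ] [NullSingletonClass μ] :
    Continuous (cdf μ) := by
  refine continuous_iff_continuousAt.2 fun x => ?_
  rw [(monotone_cdf μ).continuousAt_iff_leftLim_eq_rightLim, StieltjesFunction.rightLim_eq]
  have h := (cdf μ).measure_singleton x
  rw [measure_cdf, measure_singleton, eq_comm, ENNReal.ofReal_eq_zero] at h
  exact le_antisymm ((monotone_cdf μ).leftLim_le le_rfl) (by linarith)

theorem exists_cdf_eq (μ : Measure ℝ) [IsProbabilityMeasure μ] [NullSingletonClass μ] {s : ℝ}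
    (h0 : 0 < s) (h1 : s < 1) : ∃ x, cdf μ x = s := by
  obtain ⟨a, ha⟩ := ((tendsto_cdf_atBot μ).eventually_lt_const h0).exists
  obtain ⟨b, hb⟩ := ((tendsto_cdf_atTop μ).eventually_const_lt h1).exists
  exact mem_range_of_exists_le_of_exists_ge (continuous_cdf μ) ⟨a, ha.le⟩ ⟨b, hb.le⟩

theorem measureReal_cdf_le (μ : Measure ℝ) [IsProbabilityMeasure μ] [NullSingletonClass μ] (s : ℝ) :
    μ.real {x | cdf μ x ≤ s} = max 0 (min s 1) := by
  have lower : ∀ s, 0 < s → s < 1 → s ≤ μ.real {x | cdf μ x ≤ s} := by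
    intro s h0 h1
    obtain ⟨x, hx⟩ := exists_cdf_eq μ h0 h1
    calc s = μ.real (Iic x) := by rw [← cdf_eq_real, hx]
      _ ≤ _ := measureReal_mono fun y hy => (monotone_cdf μ hy).trans hx.le
  have upper : ∀ s s', s < s' → 0 < s' → s' < 1 → μ.real {x | cdf μ x ≤ s} ≤ s' := by
    intro s s' h h0 h1
    obtain ⟨x, hx⟩ := exists_cdf_eq μ h0 h1
    calc μ.real {x | cdf μ x ≤ s} ≤ μ.real (Iic x) := by
          refine measureReal_mono fun y hy => mem_Iic.2 <| le_of_not_gt fun hlt => ?_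
          exact absurd (hx.symm.le.trans ((monotone_cdf μ hlt.le).trans hy)) (not_le.2 h)
      _ = s' := by rw [← cdf_eq_real, hx]
  rcases le_or_gt 1 s with h1 | h1
  · have : {x | cdf μ x ≤ s} = univ := eq_univ_of_forall fun x => (cdf_le_one μ x).trans h1
    rw [this, probReal_univ, min_eq_right h1, max_eq_right zero_le_one]
  rw [min_eq_left h1.le]
  refine le_antisymm (le_of_forall_gt_imp_ge_of_dense fun s' hs' => ?_) (max_le (by simp) ?_)
  · rw [max_lt_iff] at hs'
    rcases lt_or_ge s' 1 with h | h
    · exact upper s s' hs'.2 hs'.1 h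
    · exact measureReal_le_one.trans h
  · rcases le_or_gt s 0 with h | h
    · exact h.trans measureReal_nonneg
    · exact lower s h h1

theorem map_cdf_sub_half (μ : Measure ℝ) [IsProbabilityMeasure μ] [NullSingletonClass μ] :
    μ.map (fun x => cdf μ x - 1 / 2) = volume.restrict (Ioc (-(1 / 2)) (1 / 2)) := by
  have hm : Measurable fun x => cdf μ x - 1 / 2 :=
    ((continuous_cdf μ).sub continuous_const).measurable
  have := Measure.isProbabilityMeasure_map (μ := μ) hm.aemeasurable
  refine Measure.ext_of_Iic _ _ fun t => ?_
  rw [Measure.map_apply hm measurableSet_Iic, Measure.restrict_apply measurableSet_Iic,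
    inter_comm, Ioc_inter_Iic, Real.volume_Ioc, ← ofReal_measureReal]
  have h : (fun x => cdf μ x - 1 / 2) ⁻¹' Iic t = {x | cdf μ x ≤ t + 1 / 2} := by
    ext x
    simp
  have hmin : min (1 / 2) t - -(1 / 2) = min (t + 1 / 2) 1 := by
    rw [sub_neg_eq_add, ← min_add_add_right, min_comm, add_halves]
  rw [h, measureReal_cdf_le, hmin]
  rcases le_total 0 (min (t + 1 / 2) 1) with h0 | h0
  · rw [max_eq_right h0]
  · rw [max_eq_left h0, ENNReal.ofReal_zero, ENNReal.ofReal_of_nonpos h0]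

theorem cdf_neg (μ : Measure ℝ) [IsProbabilityMeasure μ] [NullSingletonClass μ]
    (hμ : MeasurePreserving Neg.neg μ μ) (x : ℝ) : cdf μ (-x) = 1 - cdf μ x := by
  have h : Neg.neg ⁻¹' Iic (-x) = Ici x := by ext; simp
  rw [cdf_eq_real, cdf_eq_real, ← probReal_compl_eq_one_sub measurableSet_Iic, compl_Iic,
    measureReal_def, measureReal_def, ← hμ.measure_preimage measurableSet_Iic.nullMeasurableSet,
    h, Ioi_ae_eq_Ici.measure_eq]

end ProbabilityIntegralTransform

section Invariance

variable {n : ℕ}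

theorem exists_walk_sub_eq {a b : Fin (n + 1)} (hab : a ≠ b)
    (h : |((a : ℕ) : ℤ) - ((b : ℕ) : ℤ)| ≤ 2) :
    ∃ (c : ℝ) (p q : Fin n), ∀ x, walk n x a - walk n x b = c * (x p + x q) := by
  wlog hlt : b < a generalizing a b
  · obtain ⟨c, p, q, hx⟩ := this hab.symm (by rwa [abs_sub_comm])
      (lt_of_le_of_ne (not_lt.1 hlt) hab)
    exact ⟨-c, p, q, fun x => by rw [← neg_sub, hx, neg_mul]⟩
  have hlt' : (b : ℕ) < a := hlt
  have ha := a.isLt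
  rw [abs_le] at h
  rcases (by omega : (a : ℕ) = b + 1 ∨ (a : ℕ) = b + 2) with h1 | h2
  · refine ⟨1 / 2, ⟨b, by omega⟩, ⟨b, by omega⟩, fun x => ?_⟩
    have e1 := walk_succ x ⟨b, by omega⟩
    have e2 : (⟨b, by omega⟩ : Fin n).succ = a := Fin.ext (by simp [h1])
    have e3 : (⟨b, by omega⟩ : Fin n).castSucc = b := rfl
    rw [e2, e3] at e1
    rw [e1]; ring
  · refine ⟨1, ⟨b, by omega⟩, ⟨b + 1, by omega⟩, fun x => ?_⟩
    have e1 := walk_succ x ⟨b, by omega⟩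
    have e4 := walk_succ x ⟨b + 1, by omega⟩
    have e2 : (⟨b + 1, by omega⟩ : Fin n).succ = a := Fin.ext (by simp [h2])
    have e3 : (⟨b, by omega⟩ : Fin n).castSucc = b := rfl
    have e5 : (⟨b, by omega⟩ : Fin n).succ = (⟨b + 1, by omega⟩ : Fin n).castSucc := rfl
    rw [e3, e5] at e1
    rw [e2, e1] at e4
    rw [e4]; ring

theorem Monotone.mul_add_comp_pos_imp {φ : ℝ → ℝ} (hφ : Monotone φ) (hodd : ∀ x, φ (-x) = -φ x)
    {c s t : ℝ} (h : 0 < c * (φ s + φ t)) : 0 < c * (s + t) := by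
  have hneg : ∀ {s t}, s + t ≤ 0 → φ s + φ t ≤ 0 := fun {s t} h => by
    have := hφ (by linarith : s ≤ -t)
    rw [hodd] at this
    linarith
  have hpos : ∀ {s t}, 0 ≤ s + t → 0 ≤ φ s + φ t := fun {s t} h => by
    have := hφ (by linarith : -t ≤ s)
    rw [hodd] at this
    linarith
  rcases pos_and_pos_or_neg_and_neg_of_mul_pos h with ⟨hc, h⟩ | ⟨hc, h⟩
  · exact mul_pos hc (not_le.1 fun h' => absurd (hneg h') (not_le.2 h))
  · exact mul_pos_of_neg_of_neg hc (not_le.1 fun h' => absurd (hpos h') (not_le.2 h))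

theorem pi_D_eq_pi_uniform (π : Equiv.Perm (Fin (n + 1)))
    (hac : ∀ i : Fin n, |((π.symm i.succ : ℕ) : ℤ) - ((π.symm i.castSucc : ℕ) : ℤ)| ≤ 2)
    (μ : Measure ℝ) [IsProbabilityMeasure μ] [NullSingletonClass μ] (hμ : MeasurePreserving Neg.neg μ μ) :
    Measure.pi (fun _ : Fin n => μ) (D n π) =
      Measure.pi (fun _ : Fin n => volume.restrict (Ioc (-(1 / 2) : ℝ) (1 / 2))) (D n π) := by
  set φ : ℝ → ℝ := fun x => ProbabilityTheory.cdf μ x - 1 / 2 with hφ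
  have hmono : Monotone φ := fun x y h => sub_le_sub_right (ProbabilityTheory.monotone_cdf μ h) _
  have hodd : ∀ x, φ (-x) = -φ x := fun x => by simp only [hφ, cdf_neg μ hμ]; ring
  have hmap : μ.map φ = volume.restrict (Ioc (-(1 / 2)) (1 / 2)) := map_cdf_sub_half μ
  have := Measure.isProbabilityMeasure_map (μ := μ) hmono.measurable.aemeasurable
  have hpush : (Measure.pi fun _ : Fin n => μ).map (fun x i => φ (x i)) =
      Measure.pi (fun _ : Fin n => volume.restrict (Ioc (-(1 / 2) : ℝ) (1 / 2))) := by
    rw [Measure.pi_map_pi fun _ => hmono.measurable.aemeasurable, hmap]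
  have hmeas : Measurable fun (x : Fin n → ℝ) i => φ (x i) :=
    measurable_pi_lambda _ fun i => hmono.measurable.comp (measurable_pi_apply i)
  have hform : ∀ j : Fin n, ∃ (c : ℝ) (p q : Fin n),
      ∀ x, (L n π.symm).mulVec x j = c * (x p + x q) := fun j => by
    simp only [L_mulVec_apply]
    exact exists_walk_sub_eq (by simp [Fin.ext_iff]) (hac j)
  choose c p q hL using hform
  have hnull : Measure.pi (fun _ : Fin n => μ)
      ((fun x i => φ (x i)) ⁻¹' {x | ∃ j, (L n π.symm).mulVec x j = 0}) = 0 := by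
    refine le_antisymm ((Measure.le_map_apply hmeas.aemeasurable _).trans ?_) zero_le
    rw [hpush, ← Measure.restrict_pi_pi, ← volume_pi]
    exact (Measure.restrict_apply_le _ _).trans (volume_exists_L_mulVec_eq_zero π.symm).le
  rw [← hpush, Measure.map_apply hmeas (measurableSet_D π)]
  refine le_antisymm ?_ (measure_mono fun x hx => ?_)
  · rw [← add_zero (Measure.pi _ (_ ⁻¹' D n π)), ← hnull]
    refine (measure_mono fun x hx => ?_).trans (measure_union_le _ _)
    by_cases h : ∃ j, (L n π.symm).mulVec (fun i => φ (x i)) j = 0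
    · exact Or.inr h
    · left
      push Not at h
      rw [mem_preimage, mem_D_iff]
      intro j
      refine lt_of_le_of_ne (not_lt.1 fun hneg => ?_) (h j).symm
      have hx' := (mem_D_iff π x).1 hx j
      rw [hL] at hneg hx'
      have := hmono.mul_add_comp_pos_imp hodd (c := -c j) (neg_mul (c j) _ ▸ neg_pos.2 hneg)
      linarith
  · rw [mem_preimage, mem_D_iff] at hx
    rw [mem_D_iff]
    intro j
    have := hx j
    rw [hL] at this ⊢
    exact hmono.mul_add_comp_pos_imp hodd this

theorem pi_withDensity_ofReal {ι : Type*} [Fintype ι] {f : ℝ → ℝ} (hf : Integrable f)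
    (hpos : ∀ x, 0 ≤ f x) :
    Measure.pi (fun _ : ι => volume.withDensity fun x => ENNReal.ofReal (f x)) =
      volume.withDensity fun x : ι → ℝ => ENNReal.ofReal (∏ i, f (x i)) := by
  have := isFiniteMeasure_withDensity_ofReal hf.2
  refine Measure.pi_eq fun s hs => ?_
  rw [withDensity_apply _ (MeasurableSet.univ_pi hs), volume_pi, Measure.restrict_pi_pi,
    ← ofReal_integral_eq_lintegral_ofReal
      (Integrable.fintype_prod (f := fun _ => f) fun i => hf.restrict)
      (ae_of_all _ fun x => Finset.prod_nonneg fun i _ => hpos _),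
    integral_fintype_prod_eq_prod (f := fun _ => f),
    ENNReal.ofReal_prod_of_nonneg fun i _ => integral_nonneg hpos]
  refine Finset.prod_congr rfl fun i _ => ?_
  rw [withDensity_apply _ (hs i), ofReal_integral_eq_lintegral_ofReal hf.restrict
    (ae_of_all _ hpos)]

theorem setIntegral_D_eq_uniform (π : Equiv.Perm (Fin (n + 1)))
    (hac : ∀ i : Fin n, |((π.symm i.succ : ℕ) : ℤ) - ((π.symm i.castSucc : ℕ) : ℤ)| ≤ 2)
    {f : ℝ → ℝ} (hmeas : Measurable f) (hpos : ∀ x, 0 ≤ f x) (hint : ∫ x, f x = 1)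
    (hsymm : ∀ x, f (-x) = f x) :
    ∫ x in D n π, ∏ i : Fin n, f (x i) =
      (Measure.pi fun _ : Fin n => volume.restrict (Ioc (-(1 / 2) : ℝ) (1 / 2))).real (D n π) := by
  have hf : Integrable f := Integrable.of_integral_ne_zero (by rw [hint]; exact one_ne_zero)
  set μ : Measure ℝ := volume.withDensity fun x => ENNReal.ofReal (f x) with hμ
  have : IsProbabilityMeasure μ := ⟨by
    rw [hμ, withDensity_apply _ MeasurableSet.univ, Measure.restrict_univ,
      ← ofReal_integral_eq_lintegral_ofReal hf (ae_of_all _ hpos), hint, ENNReal.ofReal_one]⟩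
  have hna : NullSingletonClass μ := ⟨fun x => withDensity_absolutelyContinuous _ _ (measure_singleton x)⟩
  have hneg : MeasurePreserving Neg.neg μ μ := by
    refine ⟨measurable_neg, Measure.ext fun s hs => ?_⟩
    rw [Measure.map_apply measurable_neg hs, hμ, withDensity_apply _ (measurable_neg hs),
      withDensity_apply _ hs, ← (Measure.measurePreserving_neg volume).setLIntegral_comp_preimage hs
        hmeas.ennreal_ofReal]
    simp only [hsymm]
  rw [measureReal_def, ← pi_D_eq_pi_uniform π hac μ hneg, hμ, pi_withDensity_ofReal hf hpos,
    withDensity_apply _ (measurableSet_D π), integral_eq_lintegral_of_nonneg_ae]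
  · exact ae_of_all _ fun x => Finset.prod_nonneg fun i _ => hpos _
  · exact (Finset.measurable_prod _ fun i _ =>
      hmeas.comp (measurable_pi_apply i)).aestronglyMeasurable

end Invariance

/-- for an almost consecutive permutation and any symmetric density,
`P(f,π) = 1/(2^n ∏_j lev(π)_j)`. -/
theorem stmt_8 (n : ℕ) (hn : 1 ≤ n) (π : Equiv.Perm (Fin (n + 1)))
    (hac : ∀ i : Fin n, |((π.symm i.succ : ℕ) : ℤ) - ((π.symm i.castSucc : ℕ) : ℤ)| ≤ 2)
    (f : ℝ → ℝ) (hmeas : Measurable f) (hpos : ∀ x, 0 ≤ f x) (hint : ∫ x, f x = 1)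
    (hsymm : ∀ x, f (-x) = f x) :
    ∫ x in D n π, ∏ i : Fin n, f (x i) =
    1 / (2 ^ n * ∏ j : Fin n, (lev n π j : ℝ)) := by
  rw [setIntegral_D_eq_uniform π hac hmeas hpos hint hsymm, ← setIntegral_D_laplace π]
  exact (setIntegral_D_eq_uniform (f := fun x => Real.exp (-|x|) / 2) π hac (by fun_prop)
    (fun x => by positivity) integral_exp_neg_abs_div_two fun x => by rw [abs_neg]).symm
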